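/- arXiv:2406.17649 — 7 statements merged into one kernel-verified Lean document; each statement's English description precedes it below -/
import Mathlib

section
/- Let S and A be finite nonempty sets, γ ∈ [0, 1), r : S × A → ℝ, and let P, P̃ : S × A → PMF(S) be two transition kernels. Let π : S → PMF(A) be a stationary policy. Suppose Q : S × A → ℝ satisfies the Bellman equation Q(s,a) = r(s,a) + γ·Σ_{s'} P(s' | s,a)·Σ_{a'} π(a' | s')·Q(s',a') for all (s,a), and Q̃ : S × A → ℝ satisfies the same equation with P replaced by P̃. Define V(s') = Σ_{a'} π(a' | s')·Q(s',a'). Then max_{s,a} |Q(s,a) − Q̃(s,a)| ≤ (γ / (1 − γ)) · max_{s,a} | Σ_{s'} ( P(s' | s,a) − P̃(s' | s,a) ) · V(s') |. -/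
open scoped BigOperators

theorem pmf_avg_abs_le {T : Type*} [Fintype T] (p : PMF T) (f : T → ℝ) (D : ℝ)
    (hf : ∀ t, |f t| ≤ D) : |∑ t, (p t).toReal * f t| ≤ D := by
  have hs : ∑ t, (p t).toReal = 1 := by
    rw [← ENNReal.toReal_sum (fun t _ => p.apply_ne_top t), ← tsum_fintype (L := .unconditional T),
      p.tsum_coe, ENNReal.toReal_one]
  calc |∑ t, (p t).toReal * f t| ≤ ∑ t, |(p t).toReal * f t| := Finset.abs_sum_le_sum_abs _ _
    _ ≤ ∑ t, (p t).toReal * D := by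
        refine Finset.sum_le_sum fun t _ => ?_
        rw [abs_mul, abs_of_nonneg ENNReal.toReal_nonneg]
        exact mul_le_mul_of_nonneg_left (hf t) ENNReal.toReal_nonneg
    _ = D := by rw [← Finset.sum_mul, hs, one_mul]

/-- The Simulation Lemma: if `Q` and `Q'` satisfy the Bellman equation for the same policy `π`
and reward `r` but with transition kernels `P` and `P'`, then
`max_{s,a} |Q s a - Q' s a| ≤ γ/(1-γ) · max_{s,a} |Σ_{s'} (P(s'|s,a) - P'(s'|s,a)) V(s')|`,
where `V s' = Σ_{a'} π(a'|s') Q s' a'`. -/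
theorem simulation_lemma
    {S A : Type*} [Fintype S] [Nonempty S] [Fintype A] [Nonempty A]
    (γ : ℝ) (hγ0 : 0 ≤ γ) (hγ1 : γ < 1)
    (r : S → A → ℝ) (P P' : S → A → PMF S) (π : S → PMF A)
    (Q Q' : S → A → ℝ)
    (hQ : ∀ s a, Q s a =
      r s a + γ * ∑ s', (P s a s').toReal * ∑ a', (π s' a').toReal * Q s' a')
    (hQ' : ∀ s a, Q' s a =
      r s a + γ * ∑ s', (P' s a s').toReal * ∑ a', (π s' a').toReal * Q' s' a') :
    (⨆ p : S × A, |Q p.1 p.2 - Q' p.1 p.2|) ≤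
      γ / (1 - γ) *
        ⨆ p : S × A, |∑ s', ((P p.1 p.2 s').toReal - (P' p.1 p.2 s').toReal) *
          ∑ a', (π s' a').toReal * Q s' a'| := by
  set D := ⨆ p : S × A, |Q p.1 p.2 - Q' p.1 p.2| with hD
  set E := ⨆ p : S × A, |∑ s', ((P p.1 p.2 s').toReal - (P' p.1 p.2 s').toReal) *
          ∑ a', (π s' a').toReal * Q s' a'| with hE
  have hDle : ∀ s a, |Q s a - Q' s a| ≤ D := fun s a =>
    le_ciSup (f := fun p : S × A => |Q p.1 p.2 - Q' p.1 p.2|) (Set.finite_range _).bddAbove (s, a)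
  have hEle : ∀ s a, |∑ s', ((P s a s').toReal - (P' s a s').toReal) *
          ∑ a', (π s' a').toReal * Q s' a'| ≤ E := fun s a =>
    le_ciSup (f := fun p : S × A => |∑ s', ((P p.1 p.2 s').toReal - (P' p.1 p.2 s').toReal) *
          ∑ a', (π s' a').toReal * Q s' a'|) (Set.finite_range _).bddAbove (s, a)
  have key : D ≤ γ * (E + D) := by
    refine ciSup_le fun p => ?_
    obtain ⟨s, a⟩ := p
    have h2 : |∑ s', (P' s a s').toReal * ∑ a', (π s' a').toReal * (Q s' a' - Q' s' a')| ≤ D :=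
      pmf_avg_abs_le _ _ _ fun s' => pmf_avg_abs_le _ _ _ fun a' => hDle s' a'
    have h1 : Q s a - Q' s a = γ * ((∑ s', ((P s a s').toReal - (P' s a s').toReal) *
          ∑ a', (π s' a').toReal * Q s' a') +
          ∑ s', (P' s a s').toReal * ∑ a', (π s' a').toReal * (Q s' a' - Q' s' a')) := by
      rw [hQ s a, hQ' s a]
      simp only [mul_sub, sub_mul, Finset.sum_sub_distrib]
      ring
    change |Q s a - Q' s a| ≤ _
    rw [h1, abs_mul, abs_of_nonneg hγ0]
    exact mul_le_mul_of_nonneg_left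
      ((abs_add_le _ _).trans (add_le_add (hEle s a) h2)) hγ0
  have hpos : 0 < 1 - γ := by linarith
  rw [div_mul_eq_mul_div, le_div_iff₀ hpos]
  linarith
end

section
/- Let S and A be finite nonempty sets, γ ∈ [0, 1), r_max > 0, and r : S × A → [0, r_max]. Let P, P̃ : S × A → PMF(S) be two transition kernels and π : S → PMF(A) a stationary policy. Suppose Q : S × A → ℝ satisfies the Bellman equation Q(s,a) = r(s,a) + γ·Σ_{s'} P(s' | s,a)·Σ_{a'} π(a' | s')·Q(s',a') for all (s,a), and Q̃ satisfies the same equation with P replaced by P̃. Then max_{s,a} |Q(s,a) − Q̃(s,a)| ≤ ( γ·r_max / (1 − γ)² ) · max_{s,a} ‖ P(· | s,a) − P̃(· | s,a) ‖₁. -/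
open scoped BigOperators

theorem pmf_avg_le {α : Type*} [Fintype α] (p : PMF α) (f : α → ℝ) (C : ℝ)
    (hf : ∀ x, |f x| ≤ C) : |∑ x, (p x).toReal * f x| ≤ C := by
  have h1 : ∑ x, (p x).toReal = 1 := by
    rw [← ENNReal.toReal_sum (fun x _ => p.apply_ne_top x), ← tsum_fintype (L := .unconditional _),
      p.tsum_coe, ENNReal.toReal_one]
  calc |∑ x, (p x).toReal * f x| ≤ ∑ x, |(p x).toReal * f x| := Finset.abs_sum_le_sum_abs _ _
    _ ≤ ∑ x, (p x).toReal * C := by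
        apply Finset.sum_le_sum
        intro x _
        rw [abs_mul, abs_of_nonneg ENNReal.toReal_nonneg]
        exact mul_le_mul_of_nonneg_left (hf x) ENNReal.toReal_nonneg
    _ = C := by rw [← Finset.sum_mul, h1, one_mul]

/-- Corollary of the Simulation Lemma: with rewards in `[0, r_max]`, if `Q` and `Q'` satisfy the
Bellman equation for the same policy `π` but with transition kernels `P` and `P'`, then
`max_{s,a} |Q s a - Q' s a| ≤ γ·r_max/(1-γ)² · max_{s,a} ‖P(·|s,a) - P'(·|s,a)‖₁`. -/
theorem simulation_lemma_l1
    {S A : Type*} [Fintype S] [Nonempty S] [Fintype A] [Nonempty A]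
    (γ : ℝ) (hγ0 : 0 ≤ γ) (hγ1 : γ < 1)
    (rmax : ℝ) (hrmax : 0 < rmax)
    (r : S → A → ℝ) (hr : ∀ s a, r s a ∈ Set.Icc (0 : ℝ) rmax)
    (P P' : S → A → PMF S) (π : S → PMF A)
    (Q Q' : S → A → ℝ)
    (hQ : ∀ s a, Q s a =
      r s a + γ * ∑ s', (P s a s').toReal * ∑ a', (π s' a').toReal * Q s' a')
    (hQ' : ∀ s a, Q' s a =
      r s a + γ * ∑ s', (P' s a s').toReal * ∑ a', (π s' a').toReal * Q' s' a') :
    (⨆ p : S × A, |Q p.1 p.2 - Q' p.1 p.2|) ≤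
      γ * rmax / (1 - γ) ^ 2 *
        ⨆ p : S × A, ∑ s', |(P p.1 p.2 s').toReal - (P' p.1 p.2 s').toReal| := by
  have hg : 0 < 1 - γ := by linarith
  -- bound on Q
  obtain ⟨p, hp⟩ := Finite.exists_max (fun p : S × A => |Q p.1 p.2|)
  have hM : |Q p.1 p.2| ≤ rmax / (1 - γ) := by
    have h1 := pmf_avg_le (P p.1 p.2) (fun s' => ∑ a', (π s' a').toReal * Q s' a') |Q p.1 p.2|
      (fun s' => pmf_avg_le (π s') (Q s') _ (fun a' => hp (s', a')))
    have h2 := hr p.1 p.2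
    have h3 : |Q p.1 p.2| ≤ rmax + γ * |Q p.1 p.2| := by
      conv_lhs => rw [hQ]
      refine (abs_add_le _ _).trans (add_le_add ?_ ?_)
      · rw [abs_of_nonneg h2.1]; exact h2.2
      · rw [abs_mul, abs_of_nonneg hγ0]; exact mul_le_mul_of_nonneg_left h1 hγ0
    rw [le_div_iff₀ hg]; linarith
  have hV : ∀ s', |∑ a', (π s' a').toReal * Q s' a'| ≤ rmax / (1 - γ) := fun s' =>
    pmf_avg_le (π s') (Q s') _ (fun a' => (hp (s', a')).trans hM)
  set E := ⨆ p : S × A, ∑ s', |(P p.1 p.2 s').toReal - (P' p.1 p.2 s').toReal| with hE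
  obtain ⟨q, hq⟩ := Finite.exists_max (fun p : S × A => |Q p.1 p.2 - Q' p.1 p.2|)
  have hEq : ∑ s', |(P q.1 q.2 s').toReal - (P' q.1 q.2 s').toReal| ≤ E :=
    le_ciSup (f := fun p : S × A => ∑ s', |(P p.1 p.2 s').toReal - (P' p.1 p.2 s').toReal|)
      (Set.finite_range _).bddAbove q
  refine (ciSup_le hq).trans ?_
  set D := |Q q.1 q.2 - Q' q.1 q.2| with hD
  have hW : |∑ s', (P' q.1 q.2 s').toReal * ∑ a', (π s' a').toReal * (Q s' a' - Q' s' a')| ≤ D :=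
    pmf_avg_le _ _ _ (fun s' => pmf_avg_le (π s') (fun a' => Q s' a' - Q' s' a') _
      (fun a' => hq (s', a')))
  have hU : |∑ s', ((P q.1 q.2 s').toReal - (P' q.1 q.2 s').toReal) *
      ∑ a', (π s' a').toReal * Q s' a'| ≤ E * (rmax / (1 - γ)) := by
    refine (Finset.abs_sum_le_sum_abs _ _).trans ?_
    refine le_trans ?_ (mul_le_mul_of_nonneg_right hEq (by positivity))
    rw [Finset.sum_mul]
    apply Finset.sum_le_sum
    intro s' _
    rw [abs_mul]
    exact mul_le_mul_of_nonneg_left (hV s') (abs_nonneg _)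
  have hdec : Q q.1 q.2 - Q' q.1 q.2 = γ * (∑ s', ((P q.1 q.2 s').toReal -
      (P' q.1 q.2 s').toReal) * ∑ a', (π s' a').toReal * Q s' a' +
      ∑ s', (P' q.1 q.2 s').toReal * ∑ a', (π s' a').toReal * (Q s' a' - Q' s' a')) := by
    rw [hQ q.1 q.2, hQ' q.1 q.2]
    simp only [mul_sub, sub_mul, Finset.sum_sub_distrib]
    ring
  have hfin : D ≤ γ * (E * (rmax / (1 - γ)) + D) := by
    conv_lhs => rw [hD, hdec, abs_mul, abs_of_nonneg hγ0]
    exact mul_le_mul_of_nonneg_left ((abs_add_le _ _).trans (add_le_add hU hW)) hγ0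
  have h5 : D ≤ γ * (E * (rmax / (1 - γ))) / (1 - γ) := by
    rw [le_div_iff₀ hg]; linarith
  refine h5.trans (le_of_eq ?_)
  field_simp
end

section
/- Let S be a finite nonempty set, p a probability mass function on S, and M : S → PMF(S) a Markov kernel with M(s | s) > 0 for every s ∈ S. Define the smoothed distribution (pM)(s') = Σ_{s∈S} p(s)·M(s' | s). Then the Kullback–Leibler divergence satisfies D_KL( p ‖ pM ) ≤ −Σ_{s'∈S} p(s')·log M(s' | s') ≤ −log ( min_{s'∈S} M(s' | s') ). -/
open scoped BigOperators

/-- KL-divergence bound for a smoothed distribution: if `p` is a probability mass function on a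
finite set `S` and `M` is a Markov kernel with `M s s > 0` for all `s`, then
`D_KL(p ‖ pM) ≤ -Σ_{s'} p s' · log (M s' s') ≤ -log (min_{s'} M s' s')`,
where `(pM) s' = Σ_s p s · M s s'`. -/
theorem kl_smoothing_bound
    {S : Type*} [Fintype S] [Nonempty S]
    (p : S → ℝ) (hp0 : ∀ s, 0 ≤ p s) (hp1 : ∑ s, p s = 1)
    (M : S → S → ℝ) (hM0 : ∀ s s', 0 ≤ M s s') (hM1 : ∀ s, ∑ s', M s s' = 1)
    (hMdiag : ∀ s, 0 < M s s) :
    (∑ s', p s' * Real.log (p s' / ∑ s, p s * M s s')) ≤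
        -∑ s', p s' * Real.log (M s' s') ∧
      -∑ s', p s' * Real.log (M s' s') ≤
        -Real.log (Finset.univ.inf' Finset.univ_nonempty fun s' => M s' s') := by
  constructor
  · rw [← Finset.sum_neg_distrib]
    apply Finset.sum_le_sum
    intro s' _
    rcases (hp0 s').eq_or_lt with h | h
    · simp [← h]
    · rw [← mul_neg, ← Real.log_inv]
      have h1 : p s' * M s' s' ≤ ∑ s, p s * M s s' :=
        Finset.single_le_sum (f := fun s => p s * M s s')
          (fun s _ => mul_nonneg (hp0 s) (hM0 s s')) (Finset.mem_univ s')
      have h2 : 0 < p s' * M s' s' := mul_pos h (hMdiag s')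
      have h3 := hMdiag s'
      apply mul_le_mul_of_nonneg_left _ h.le
      apply Real.log_le_log (div_pos h (h2.trans_le h1))
      rw [div_le_iff₀ (h2.trans_le h1), inv_mul_eq_div, le_div_iff₀ h3]
      exact h1
  · apply neg_le_neg
    have hm : 0 < Finset.univ.inf' Finset.univ_nonempty fun s' => M s' s' := by
      rw [Finset.lt_inf'_iff]
      exact fun s _ => hMdiag s
    calc _ = ∑ s', p s' * Real.log (Finset.univ.inf' Finset.univ_nonempty fun s' => M s' s') := by
          rw [← Finset.sum_mul, hp1, one_mul]
      _ ≤ _ := by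
          apply Finset.sum_le_sum
          intro s _
          apply mul_le_mul_of_nonneg_left _ (hp0 s)
          exact Real.log_le_log hm (Finset.inf'_le (fun s' => M s' s') (Finset.mem_univ s))
end

section
/- Let S be a finite nonempty set, p a probability mass function on S, and M : S → PMF(S) a Markov kernel. Define (pM)(s') = Σ_{s∈S} p(s)·M(s' | s). Then ‖ p − pM ‖₁ ≤ 2·√( 1 − min_{s'∈S} M(s' | s') ). -/
open scoped BigOperators

/-- `ℓ₁` bound for a smoothed distribution: if `p` is a probability mass function on a finite set
`S` and `M` is a Markov kernel, then `‖p - pM‖₁ ≤ 2·√(1 - min_{s'} M s' s')`,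
where `(pM) s' = Σ_s p s · M s s'`. -/
theorem l1_smoothing_bound
    {S : Type*} [Fintype S] [Nonempty S]
    (p : S → ℝ) (hp0 : ∀ s, 0 ≤ p s) (hp1 : ∑ s, p s = 1)
    (M : S → S → ℝ) (hM0 : ∀ s s', 0 ≤ M s s') (hM1 : ∀ s, ∑ s', M s s' = 1) :
    ∑ s', |p s' - ∑ s, p s * M s s'| ≤
      2 * Real.sqrt (1 - Finset.univ.inf' Finset.univ_nonempty fun s' => M s' s') := by
  set m := Finset.univ.inf' Finset.univ_nonempty fun s' => M s' s' with hm
  have hmle : ∀ s, m ≤ M s s := fun s => Finset.inf'_le _ (Finset.mem_univ s)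
  have hm0 : 0 ≤ m := by
    rw [hm]
    exact Finset.le_inf' _ _ (fun s _ => hM0 s s)
  have hm1 : m ≤ 1 := by
    obtain ⟨s⟩ := (inferInstance : Nonempty S)
    refine (hmle s).trans ?_
    rw [← hM1 s]
    exact Finset.single_le_sum (fun i _ => hM0 s i) (Finset.mem_univ s)
  have hq : ∑ s', ∑ s, p s * M s s' = 1 := by
    rw [Finset.sum_comm]
    simp_rw [← Finset.mul_sum, hM1, mul_one]
    exact hp1
  have hb : ∀ s', |p s' - ∑ s, p s * M s s'| ≤
      2 * (1 - m) * p s' - (p s' - ∑ s, p s * M s s') := by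
    intro s'
    have h1 : p s' * M s' s' ≤ ∑ s, p s * M s s' :=
      Finset.single_le_sum (f := fun s => p s * M s s')
        (fun i _ => mul_nonneg (hp0 i) (hM0 i s')) (Finset.mem_univ s')
    have h2 : p s' * m ≤ p s' * M s' s' := mul_le_mul_of_nonneg_left (hmle s') (hp0 s')
    have h3 : 0 ≤ (1 - m) * p s' := mul_nonneg (by linarith) (hp0 s')
    rw [abs_le]
    constructor <;> nlinarith
  have hsum := Finset.sum_le_sum (fun s' (_ : s' ∈ Finset.univ) => hb s')
  rw [Finset.sum_sub_distrib, Finset.sum_sub_distrib, ← Finset.mul_sum, hp1, hq] at hsum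
  have hs : 1 - m ≤ Real.sqrt (1 - m) := by
    apply Real.le_sqrt_of_sq_le
    nlinarith
  linarith
end

section
/- Let 𝒳 be a set, n a positive integer, O a finite (or countable) set, and let M : 𝒳^n → PMF(O) be a randomized mechanism satisfying ε-differential privacy: for all datasets D, D' ∈ 𝒳^n differing in at most one entry and all O' ⊆ O, P(M(D) ∈ O') ≤ e^ε · P(M(D') ∈ O'). Let u : O → [0, 1] be any utility function. Then for all datasets D, D' ∈ 𝒳^n differing in at most one entry, E_{o ∼ M(D)}[ u(o) ] ≥ E_{o ∼ M(D')}[ u(o) ] − ε. -/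
open scoped BigOperators

/-- Every `ε`-differentially private mechanism is `ε`-approximately dominant strategy truthful:
for any utility `u : O → [0,1]` and neighbouring datasets `D, D'`,
`E_{o ∼ M(D)}[u o] ≥ E_{o ∼ M(D')}[u o] - ε`. -/
theorem dp_implies_approx_truthful
    {X O : Type*} [Fintype O] (n : ℕ) (hn : 0 < n)
    (M : (Fin n → X) → PMF O) (ε : ℝ)
    (hDP : ∀ D D' : Fin n → X, (∃ i, ∀ j, j ≠ i → D j = D' j) →
      ∀ O' : Finset O,
        (∑ o ∈ O', ((M D) o).toReal) ≤ Real.exp ε * ∑ o ∈ O', ((M D') o).toReal)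
    (u : O → ℝ) (hu : ∀ o, u o ∈ Set.Icc (0 : ℝ) 1) :
    ∀ D D' : Fin n → X, (∃ i, ∀ j, j ≠ i → D j = D' j) →
      (∑ o, ((M D') o).toReal * u o) - ε ≤ ∑ o, ((M D) o).toReal * u o := by
  intro D D' h
  have h' : ∃ i, ∀ j, j ≠ i → D' j = D j := by
    obtain ⟨i, hi⟩ := h
    exact ⟨i, fun j hj => (hi j hj).symm⟩
  have hsum : ∑ o, ((M D') o).toReal = 1 := by
    rw [← ENNReal.toReal_sum (fun o _ => (M D').apply_ne_top o), ← tsum_fintype (L := .unconditional O),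
      (M D').tsum_coe, ENNReal.toReal_one]
  have hsum2 : ∑ o, ((M D) o).toReal = 1 := by
    rw [← ENNReal.toReal_sum (fun o _ => (M D).apply_ne_top o), ← tsum_fintype (L := .unconditional O),
      (M D).tsum_coe, ENNReal.toReal_one]
  have hε : 0 ≤ ε := by
    have h1 := hDP D D' h Finset.univ
    rw [hsum, hsum2, mul_one] at h1
    exact Real.one_le_exp_iff.mp h1
  have hle : ∑ o, ((M D') o).toReal * u o ≤ 1 := by
    rw [← hsum]
    exact Finset.sum_le_sum fun o _ => mul_le_of_le_one_right ENNReal.toReal_nonneg (hu o).2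
  have hnn : 0 ≤ ∑ o, ((M D') o).toReal * u o :=
    Finset.sum_nonneg fun o _ => mul_nonneg ENNReal.toReal_nonneg (hu o).1
  have key : ∑ o, ((M D') o).toReal * u o ≤ Real.exp ε * ∑ o, ((M D) o).toReal * u o := by
    rw [Finset.mul_sum]
    refine Finset.sum_le_sum fun o _ => ?_
    have h1 := hDP D' D h' {o}
    simp only [Finset.sum_singleton] at h1
    rw [← mul_assoc]
    exact mul_le_mul_of_nonneg_right h1 (hu o).1
  generalize (∑ o, ((M D') o).toReal * u o) = a at *
  generalize (∑ o, ((M D) o).toReal * u o) = b at *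
  have h2 : Real.exp (-ε) * a ≤ b := by
    have := mul_le_mul_of_nonneg_left key (Real.exp_pos (-ε)).le
    rwa [← mul_assoc, ← Real.exp_add, neg_add_cancel, Real.exp_zero, one_mul] at this
  have h3 := Real.add_one_le_exp (-ε)
  nlinarith [mul_le_mul_of_nonneg_right h3 hnn, mul_le_mul_of_nonneg_left hle hε]
end

section
/- Let S be a finite nonempty subset of ℝ^K, let S' be a finite nonempty set, let M : S → PMF(S) be a Markov kernel, and let g : S → PMF(S') satisfy ‖g(s) − g(s₁)‖₁ ≤ L·‖s − s₁‖₁ for all s, s₁ ∈ S, where L > 0. Fix s ∈ S, β > 0 and τ ∈ [0, 1], and suppose Σ_{s₁ ∈ S : ‖s − s₁‖_∞ ≥ β} M(s₁ | s) ≤ τ. Then Σ_{s₁ ∈ S} M(s₁ | s) · ‖g(s) − g(s₁)‖₁ ≤ L·K·β + 2·τ. -/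
open scoped BigOperators Classical

/-- Abstract input-privatization error bound: if `M` is a privatization kernel on a finite set
`S ⊆ ℝ^K` that concentrates within an `ℓ_∞` ball of radius `β` around its input except with
probability `τ`, and `g : S → PMF(S')` is `L`-Lipschitz from `ℓ₁` to `ℓ₁`, then
`Σ_{s₁} M(s₁ | s) · ‖g s - g s₁‖₁ ≤ L·K·β + 2·τ`. -/
theorem input_privatization_error_bound
    {K : ℕ} (hK : 0 < K) {S' : Type*} [Fintype S'] [Nonempty S']
    (S : Finset (Fin K → ℝ)) (hS : S.Nonempty)
    (M : (Fin K → ℝ) → (Fin K → ℝ) → ℝ)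
    (hM0 : ∀ s ∈ S, ∀ s₁ ∈ S, 0 ≤ M s s₁)
    (hM1 : ∀ s ∈ S, ∑ s₁ ∈ S, M s s₁ = 1)
    (g : (Fin K → ℝ) → S' → ℝ)
    (hg0 : ∀ s ∈ S, ∀ a, 0 ≤ g s a)
    (hg1 : ∀ s ∈ S, ∑ a, g s a = 1)
    (L : ℝ) (hL : 0 < L)
    (hLip : ∀ s ∈ S, ∀ s₁ ∈ S, (∑ a, |g s a - g s₁ a|) ≤ L * ∑ i, |s i - s₁ i|)
    (s : Fin K → ℝ) (hs : s ∈ S)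
    (β : ℝ) (hβ : 0 < β) (τ : ℝ) (hτ : τ ∈ Set.Icc (0 : ℝ) 1)
    (htail : (∑ s₁ ∈ S.filter fun s₁ => β ≤ ⨆ i, |s i - s₁ i|, M s s₁) ≤ τ) :
    (∑ s₁ ∈ S, M s s₁ * ∑ a, |g s a - g s₁ a|) ≤ L * K * β + 2 * τ := by
  have hLK : 0 ≤ L * K * β := by positivity
  have key : ∀ s₁ ∈ S, M s s₁ * ∑ a, |g s a - g s₁ a| ≤
      M s s₁ * (L * K * β) + 2 * (if β ≤ ⨆ i, |s i - s₁ i| then M s s₁ else 0) := by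
    intro s₁ h₁
    have hm := hM0 s hs s₁ h₁
    split_ifs with h
    · have h2 : ∑ a, |g s a - g s₁ a| ≤ 2 := by
        calc ∑ a, |g s a - g s₁ a| ≤ ∑ a, (g s a + g s₁ a) := by
              refine Finset.sum_le_sum fun a _ => ?_
              have := hg0 s hs a
              have := hg0 s₁ h₁ a
              rw [abs_le]
              constructor <;> linarith
          _ = 2 := by
              rw [Finset.sum_add_distrib, hg1 s hs, hg1 s₁ h₁]; norm_num
      have := mul_le_mul_of_nonneg_left h2 hm
      have := mul_nonneg hm hLK
      linarith
    · have h3 : ∑ i, |s i - s₁ i| ≤ K * β := by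
        calc ∑ i, |s i - s₁ i| ≤ ∑ _i : Fin K, β := by
              refine Finset.sum_le_sum fun i _ => ?_
              exact (le_ciSup (f := fun i => |s i - s₁ i|)
                (Set.finite_range _).bddAbove i).trans (not_le.mp h).le
          _ = K * β := by simp
      have h4 := (hLip s hs s₁ h₁).trans (mul_le_mul_of_nonneg_left h3 hL.le)
      have := mul_le_mul_of_nonneg_left h4 hm
      rw [← mul_assoc L] at this
      linarith
  refine (Finset.sum_le_sum key).trans ?_
  rw [Finset.sum_add_distrib, ← Finset.sum_mul, ← Finset.mul_sum, hM1 s hs,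
    ← Finset.sum_filter]
  linarith
end

section
/- Let S be a finite nonempty subset of ℝ^K, A a finite nonempty set, γ ∈ [0, 1), r_max > 0, r : S × A → [0, r_max], and L > 0. Let P : S × A → PMF(S) satisfy ‖P(· | s, a) − P(· | s', a)‖₁ ≤ L·‖s − s'‖₁ for all s, s' ∈ S and a ∈ A. Let P_M : S → PMF(S) be a kernel with all entries positive, and suppose there exist β₁ ∈ [0, 1], β > 0 and τ ∈ [0, 1] such that (i) P_M(s | s) ≥ 1 − β₁ for all s ∈ S, and (ii) Σ_{s₁ : ‖s − s₁‖_∞ ≥ β} P_M(s₁ | s) ≤ τ for all s ∈ S. Let ν : A → PMF(S) have all entries positive; define ν̃(s̃ | a) = Σ_s P_M(s̃ | s)·ν(s | a), ν(s | s̃, a) = P_M(s̃ | s)·ν(s | a) / ν̃(s̃ | a), P̄(s' | s, a) = Σ_{s₂} P(s₂ | s, a)·P_M(s' | s₂), and P̃(s̃' | s̃, a) = Σ_s ν(s | s̃, a)·P̄(s̃' | s, a). Suppose H, C > 0 satisfy ν(s₁ | a) ≤ H·ν̃(s̃ | a) and P_M(s̃ | s₁) ≤ C·P_M(s₁ | s̃)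 for all s₁, s̃ ∈ S and a ∈ A. Let Q* : S × A → ℝ satisfy the Bellman optimality equation Q*(s,a) = r(s,a) + γ·Σ_{s'} P(s' | s,a)·max_{a'} Q*(s',a'), and let Q̃* satisfy the same equation with P replaced by P̃. Then max_{s,a} |Q*(s,a) − Q̃*(s,a)| ≤ ( γ·r_max / (1 − γ)² ) · [ 2·√β₁ + H·C·( 2·τ + L·K·β ) ]. -/
open scoped BigOperators Classical

theorem aux_contr {X A : Type*} [Fintype A] [Nonempty A] (S : Finset X) (hS : S.Nonempty)
    (γ c : ℝ) (hγ1 : γ < 1) (F : X → A → ℝ)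
    (h : ∀ D, (∀ s ∈ S, ∀ a, |F s a| ≤ D) → ∀ s ∈ S, ∀ a, |F s a| ≤ c + γ * D) :
    ∀ s ∈ S, ∀ a, |F s a| ≤ c / (1 - γ) := by
  obtain ⟨p, hp, hmax⟩ := Finset.exists_max_image (S ×ˢ (Finset.univ : Finset A))
    (fun p => |F p.1 p.2|) (hS.product Finset.univ_nonempty)
  have hp1 : p.1 ∈ S := (Finset.mem_product.1 hp).1
  have hall : ∀ s ∈ S, ∀ a, |F s a| ≤ |F p.1 p.2| := fun s hs a =>
    hmax (s, a) (Finset.mem_product.2 ⟨hs, Finset.mem_univ _⟩)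
  have h1 := h _ hall p.1 hp1 p.2
  intro s hs a
  refine (hall s hs a).trans ?_
  rw [le_div_iff₀ (by linarith)]
  linarith

theorem aux_sup {A : Type*} [Fintype A] [Nonempty A] (f g : A → ℝ) (D : ℝ)
    (h : ∀ a, |f a - g a| ≤ D) : |(⨆ a, f a) - ⨆ a, g a| ≤ D := by
  have hf : BddAbove (Set.range f) := (Set.finite_range f).bddAbove
  have hg : BddAbove (Set.range g) := (Set.finite_range g).bddAbove
  have h1 : (⨆ a, f a) ≤ (⨆ a, g a) + D := ciSup_le fun a => by
    have := le_ciSup hg a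
    have := abs_le.1 (h a)
    linarith
  have h2 : (⨆ a, g a) ≤ (⨆ a, f a) + D := ciSup_le fun a => by
    have := le_ciSup hf a
    have := abs_le.1 (h a)
    linarith
  rw [abs_le]; constructor <;> linarith

theorem aux_sup0 {A : Type*} [Fintype A] [Nonempty A] (f : A → ℝ) (D : ℝ)
    (h : ∀ a, |f a| ≤ D) : |⨆ a, f a| ≤ D := by
  have := aux_sup f (fun _ => 0) D (by simpa using h)
  simpa using this

theorem aux_avg {X : Type*} (S : Finset X) (w f : X → ℝ) (D : ℝ)
    (hw : ∀ s ∈ S, 0 ≤ w s) (hw1 : ∑ s ∈ S, w s = 1) (h : ∀ s ∈ S, |f s| ≤ D) :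
    |∑ s ∈ S, w s * f s| ≤ D := by
  calc |∑ s ∈ S, w s * f s| ≤ ∑ s ∈ S, |w s * f s| := Finset.abs_sum_le_sum_abs _ _
    _ ≤ ∑ s ∈ S, w s * D := Finset.sum_le_sum fun s hs => by
        rw [abs_mul, abs_of_nonneg (hw s hs)]
        exact mul_le_mul_of_nonneg_left (h s hs) (hw s hs)
    _ = D := by rw [← Finset.sum_mul, hw1, one_mul]

/-- mixing bound for the l1 distance -/
theorem aux_mix {X : Type*} (S : Finset X) (w p : X → ℝ) (q : X → X → ℝ)
    (hw : ∀ s ∈ S, 0 ≤ w s) (hw1 : ∑ s ∈ S, w s = 1) :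
    ∑ x ∈ S, |p x - ∑ s ∈ S, w s * q s x| ≤ ∑ s ∈ S, w s * ∑ x ∈ S, |p x - q s x| := by
  calc ∑ x ∈ S, |p x - ∑ s ∈ S, w s * q s x|
      ≤ ∑ x ∈ S, ∑ s ∈ S, w s * |p x - q s x| := Finset.sum_le_sum fun x _ => by
        have : p x - ∑ s ∈ S, w s * q s x = ∑ s ∈ S, w s * (p x - q s x) := by
          simp_rw [mul_sub]
          rw [Finset.sum_sub_distrib, ← Finset.sum_mul, hw1, one_mul]
        rw [this]
        refine (Finset.abs_sum_le_sum_abs _ _).trans (Finset.sum_le_sum fun s hs => ?_)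
        rw [abs_mul, abs_of_nonneg (hw s hs)]
    _ = _ := by
        rw [Finset.sum_comm]
        simp_rw [Finset.mul_sum]

theorem aux_priv {X : Type*} [DecidableEq X] (S : Finset X) (p : X → ℝ) (M : X → X → ℝ) (b : ℝ)
    (hp : ∀ s ∈ S, 0 ≤ p s) (hp1 : ∑ s ∈ S, p s = 1)
    (hM : ∀ s ∈ S, ∀ x ∈ S, 0 ≤ M s x) (hM1 : ∀ s ∈ S, ∑ x ∈ S, M s x = 1)
    (hd : ∀ s ∈ S, 1 - b ≤ M s s) :
    ∑ x ∈ S, |p x - ∑ s ∈ S, p s * M s x| ≤ 2 * b := by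
  have key : ∀ s ∈ S, ∑ x ∈ S, |(if s = x then (1:ℝ) else 0) - M s x| ≤ 2 * b := by
    intro s hs
    have h1 := hM1 s hs
    rw [← Finset.add_sum_erase S _ hs] at h1 ⊢
    have h2 : ∑ x ∈ S.erase s, |(if s = x then (1:ℝ) else 0) - M s x|
        = ∑ x ∈ S.erase s, M s x := Finset.sum_congr rfl fun x hx => by
      have hx' := Finset.mem_erase.1 hx
      rw [if_neg (Ne.symm hx'.1), zero_sub, abs_neg, abs_of_nonneg (hM s hs x hx'.2)]
    have h3 : 0 ≤ ∑ x ∈ S.erase s, M s x := Finset.sum_nonneg fun x hx =>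
      hM s hs x (Finset.mem_erase.1 hx).2
    rw [h2, if_pos rfl, abs_of_nonneg (by linarith)]
    have := hd s hs
    linarith
  calc ∑ x ∈ S, |p x - ∑ s ∈ S, p s * M s x|
      ≤ ∑ x ∈ S, ∑ s ∈ S, p s * |(if s = x then (1:ℝ) else 0) - M s x| :=
        Finset.sum_le_sum fun x hx => by
        have : p x - ∑ s ∈ S, p s * M s x
            = ∑ s ∈ S, p s * ((if s = x then (1:ℝ) else 0) - M s x) := by
          simp_rw [mul_sub]
          rw [Finset.sum_sub_distrib]
          simp [hx]
        rw [this]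
        refine (Finset.abs_sum_le_sum_abs _ _).trans (Finset.sum_le_sum fun s hs => ?_)
        rw [abs_mul, abs_of_nonneg (hp s hs)]
    _ = ∑ s ∈ S, p s * ∑ x ∈ S, |(if s = x then (1:ℝ) else 0) - M s x| := by
        rw [Finset.sum_comm]
        simp_rw [Finset.mul_sum]
    _ ≤ ∑ s ∈ S, p s * (2 * b) := Finset.sum_le_sum fun s hs =>
        mul_le_mul_of_nonneg_left (key s hs) (hp s hs)
    _ = 2 * b := by rw [← Finset.sum_mul, hp1, one_mul]

/-- Quantitative form of the main utility theorem: the optimal value functions of the underlying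
MDP and of the induced MDP on privatized states differ by at most
`γ·r_max/(1-γ)² · (2√β₁ + H·C·(2τ + L·K·β))`, where `P` is the `L`-Lipschitz transition model,
`P_M` the privatization kernel satisfying the diagonal bound `P_M(s|s) ≥ 1 - β₁` and the
`ℓ_∞`-concentration bound with radius `β` and failure probability `τ`, `ν` the asymptotic state
distribution of the behaviour policy, and `H`, `C` the ratio bounds. -/
theorem dp_rl_utility_bound
    {K : ℕ} (hK : 0 < K) {A : Type*} [Fintype A] [Nonempty A]
    (S : Finset (Fin K → ℝ)) (hS : S.Nonempty)
    (γ : ℝ) (hγ0 : 0 ≤ γ) (hγ1 : γ < 1)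
    (rmax : ℝ) (hrmax : 0 < rmax)
    (r : (Fin K → ℝ) → A → ℝ) (hr : ∀ s ∈ S, ∀ a, r s a ∈ Set.Icc (0 : ℝ) rmax)
    (L : ℝ) (hL : 0 < L)
    -- the transition model of the underlying MDP
    (P : (Fin K → ℝ) → A → (Fin K → ℝ) → ℝ)
    (hP0 : ∀ s ∈ S, ∀ a, ∀ s' ∈ S, 0 ≤ P s a s')
    (hP1 : ∀ s ∈ S, ∀ a, ∑ s' ∈ S, P s a s' = 1)
    (hLip : ∀ s ∈ S, ∀ s' ∈ S, ∀ a,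
      (∑ s'' ∈ S, |P s a s'' - P s' a s''|) ≤ L * ∑ i, |s i - s' i|)
    -- the state-privatization kernel, with all entries positive
    (PM : (Fin K → ℝ) → (Fin K → ℝ) → ℝ)
    (hPM0 : ∀ s ∈ S, ∀ s₁ ∈ S, 0 < PM s s₁)
    (hPM1 : ∀ s ∈ S, ∑ s₁ ∈ S, PM s s₁ = 1)
    (β₁ : ℝ) (hβ₁ : β₁ ∈ Set.Icc (0 : ℝ) 1)
    (β : ℝ) (hβ : 0 < β) (τ : ℝ) (hτ : τ ∈ Set.Icc (0 : ℝ) 1)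
    (hdiag : ∀ s ∈ S, 1 - β₁ ≤ PM s s)
    (htail : ∀ s ∈ S,
      (∑ s₁ ∈ S.filter fun s₁ => β ≤ ⨆ i, |s i - s₁ i|, PM s s₁) ≤ τ)
    -- the asymptotic state distribution of the behaviour policy, with all entries positive
    (ν : A → (Fin K → ℝ) → ℝ)
    (hν0 : ∀ a, ∀ s ∈ S, 0 < ν a s) (hν1 : ∀ a, ∑ s ∈ S, ν a s = 1)
    -- derived quantities
    (νt : A → (Fin K → ℝ) → ℝ)
    (hνt : ∀ a st, νt a st = ∑ s ∈ S, PM s st * ν a s)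
    (νc : (Fin K → ℝ) → A → (Fin K → ℝ) → ℝ)
    (hνc : ∀ st a s, νc st a s = PM s st * ν a s / νt a st)
    (Pbar : (Fin K → ℝ) → A → (Fin K → ℝ) → ℝ)
    (hPbar : ∀ s a s', Pbar s a s' = ∑ s₂ ∈ S, P s a s₂ * PM s₂ s')
    (Pt : (Fin K → ℝ) → A → (Fin K → ℝ) → ℝ)
    (hPt : ∀ st a st', Pt st a st' = ∑ s ∈ S, νc st a s * Pbar s a st')
    -- the ratio bounds
    (H C : ℝ) (hH : 0 < H) (hC : 0 < C)
    (hHbound : ∀ a, ∀ s₁ ∈ S, ∀ st ∈ S, ν a s₁ ≤ H * νt a st)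
    (hCbound : ∀ s₁ ∈ S, ∀ st ∈ S, PM s₁ st ≤ C * PM st s₁)
    -- the optimal value functions satisfying the Bellman optimality equations
    (Qstar Qtstar : (Fin K → ℝ) → A → ℝ)
    (hQstar : ∀ s ∈ S, ∀ a,
      Qstar s a = r s a + γ * ∑ s' ∈ S, P s a s' * ⨆ a', Qstar s' a')
    (hQtstar : ∀ s ∈ S, ∀ a,
      Qtstar s a = r s a + γ * ∑ s' ∈ S, Pt s a s' * ⨆ a', Qtstar s' a') :
    ∀ s ∈ S, ∀ a,
      |Qstar s a - Qtstar s a| ≤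
        γ * rmax / (1 - γ) ^ 2 *
          (2 * Real.sqrt β₁ + H * C * (2 * τ + L * K * β)) := by
  have hνtpos : ∀ a, ∀ st ∈ S, 0 < νt a st := fun a st hst => by
    rw [hνt]
    exact Finset.sum_pos (fun s hs => mul_pos (hPM0 s hs st hst) (hν0 a s hs)) hS
  have hνc0 : ∀ st ∈ S, ∀ a, ∀ s ∈ S, 0 ≤ νc st a s := fun st hst a s hs => by
    rw [hνc]
    exact div_nonneg (mul_nonneg (hPM0 s hs st hst).le (hν0 a s hs).le) (hνtpos a st hst).le
  have hνc1 : ∀ st ∈ S, ∀ a, ∑ s ∈ S, νc st a s = 1 := fun st hst a => by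
    simp_rw [hνc]
    rw [← Finset.sum_div, ← hνt]
    exact div_self (hνtpos a st hst).ne'
  have hPb0 : ∀ s ∈ S, ∀ a, ∀ s' ∈ S, 0 ≤ Pbar s a s' := fun s hs a s' hs' => by
    rw [hPbar]
    exact Finset.sum_nonneg fun x hx => mul_nonneg (hP0 s hs a x hx) (hPM0 x hx s' hs').le
  have hPb1 : ∀ s ∈ S, ∀ a, ∑ s' ∈ S, Pbar s a s' = 1 := fun s hs a => by
    simp_rw [hPbar]
    rw [Finset.sum_comm, ← hP1 s hs a]
    refine Finset.sum_congr rfl fun x hx => ?_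
    rw [← Finset.mul_sum, hPM1 x hx, mul_one]
  have hPt0 : ∀ s ∈ S, ∀ a, ∀ s' ∈ S, 0 ≤ Pt s a s' := fun s hs a s' hs' => by
    rw [hPt]
    exact Finset.sum_nonneg fun x hx => mul_nonneg (hνc0 s hs a x hx) (hPb0 x hx a s' hs')
  have hPt1 : ∀ s ∈ S, ∀ a, ∑ s' ∈ S, Pt s a s' = 1 := fun s hs a => by
    simp_rw [hPt]
    rw [Finset.sum_comm, ← hνc1 s hs a]
    refine Finset.sum_congr rfl fun x hx => ?_
    rw [← Finset.mul_sum, hPb1 x hx a, mul_one]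
  have hνcle : ∀ st ∈ S, ∀ a, ∀ s ∈ S, νc st a s ≤ H * C * PM st s := fun st hst a s hs => by
    rw [hνc, div_le_iff₀ (hνtpos a st hst)]
    calc PM s st * ν a s ≤ (C * PM st s) * (H * νt a st) :=
          mul_le_mul (hCbound s hs st hst) (hHbound a s hs st hst) (hν0 a s hs).le
            (mul_nonneg hC.le (hPM0 st hst s hs).le)
      _ = _ := by ring
  -- local part
  have hloc : ∀ s ∈ S, ∀ a,
      ∑ x ∈ S, PM s x * ∑ y ∈ S, |P s a y - P x a y| ≤ 2 * τ + L * K * β := fun s hs a => by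
    have hpt : ∀ x ∈ S, PM s x * ∑ y ∈ S, |P s a y - P x a y| ≤
        2 * (if β ≤ ⨆ i, |s i - x i| then PM s x else 0) + PM s x * (L * K * β) := fun x hx => by
      have hpos := (hPM0 s hs x hx).le
      have hLK : 0 ≤ L * K * β := by positivity
      split_ifs with hb
      · have h2 : ∑ y ∈ S, |P s a y - P x a y| ≤ 2 := by
          calc ∑ y ∈ S, |P s a y - P x a y| ≤ ∑ y ∈ S, (P s a y + P x a y) :=
                Finset.sum_le_sum fun y hy => by
                  have h1 := hP0 s hs a y hy
                  have h2 := hP0 x hx a y hy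
                  rw [abs_le]; constructor <;> linarith
            _ = 2 := by rw [Finset.sum_add_distrib, hP1 s hs, hP1 x hx]; norm_num
        have := mul_le_mul_of_nonneg_left h2 hpos
        have := mul_nonneg hpos hLK
        linarith
      · push Not at hb
        have hle : ∑ i, |s i - x i| ≤ K * β := by
          calc ∑ i, |s i - x i| ≤ ∑ _i : Fin K, β := Finset.sum_le_sum fun i _ =>
                (le_ciSup (f := fun i => |s i - x i|) (Set.finite_range _).bddAbove i).trans hb.le
            _ = K * β := by simp
        have h3 := (hLip s hs x hx a).trans (mul_le_mul_of_nonneg_left hle hL.le)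
        have := mul_le_mul_of_nonneg_left h3 hpos
        linarith
    refine (Finset.sum_le_sum hpt).trans ?_
    rw [Finset.sum_add_distrib, ← Finset.mul_sum, ← Finset.sum_mul, hPM1 s hs, one_mul,
      ← Finset.sum_filter]
    have := htail s hs
    linarith
  have hsq : β₁ ≤ Real.sqrt β₁ := by
    apply Real.le_sqrt_of_sq_le
    nlinarith [hβ₁.1, hβ₁.2]
  have hTV : ∀ s ∈ S, ∀ a, ∑ y ∈ S, |P s a y - Pt s a y| ≤
      2 * Real.sqrt β₁ + H * C * (2 * τ + L * K * β) := fun s hs a => by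
    simp_rw [hPt]
    refine (aux_mix S (νc s a) (P s a) (fun x => Pbar x a) (hνc0 s hs a) (hνc1 s hs a)).trans ?_
    calc ∑ x ∈ S, νc s a x * ∑ y ∈ S, |P s a y - Pbar x a y|
        ≤ ∑ x ∈ S, (H * C * (PM s x * ∑ y ∈ S, |P s a y - P x a y|) + νc s a x * (2 * β₁)) :=
          Finset.sum_le_sum fun x hx => by
            have h1 : ∑ y ∈ S, |P x a y - Pbar x a y| ≤ 2 * β₁ := by
              simp_rw [hPbar]
              exact aux_priv S (P x a) PM β₁ (hP0 x hx a) (hP1 x hx a)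
                (fun s hs x hx => (hPM0 s hs x hx).le) hPM1 hdiag
            have h2 : ∑ y ∈ S, |P s a y - Pbar x a y| ≤
                ∑ y ∈ S, |P s a y - P x a y| + ∑ y ∈ S, |P x a y - Pbar x a y| := by
              rw [← Finset.sum_add_distrib]
              exact Finset.sum_le_sum fun y _ => abs_sub_le _ _ _
            have h3 : ∑ y ∈ S, |P s a y - Pbar x a y| ≤
                ∑ y ∈ S, |P s a y - P x a y| + 2 * β₁ := by linarith
            have h4 := mul_le_mul_of_nonneg_left h3 (hνc0 s hs a x hx)
            have h5 := mul_le_mul_of_nonneg_right (hνcle s hs a x hx)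
              (Finset.sum_nonneg fun y (_ : y ∈ S) => abs_nonneg (P s a y - P x a y))
            linarith
      _ = H * C * (∑ x ∈ S, PM s x * ∑ y ∈ S, |P s a y - P x a y|) + 2 * β₁ := by
          rw [Finset.sum_add_distrib, ← Finset.mul_sum, ← Finset.sum_mul, hνc1 s hs a, one_mul]
      _ ≤ _ := by
          have := mul_le_mul_of_nonneg_left (hloc s hs a) (mul_nonneg hH.le hC.le)
          linarith
  -- bound on the value function
  have hQb := aux_contr S hS γ rmax hγ1 Qstar fun D hD s hs a => by
    rw [hQstar s hs a]
    have h1 := aux_avg S (P s a) (fun s' => ⨆ a', Qstar s' a') D (hP0 s hs a) (hP1 s hs a)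
      (fun x hx => aux_sup0 _ D (hD x hx))
    have h2 := hr s hs a
    refine (abs_add_le _ _).trans ?_
    rw [abs_mul, abs_of_nonneg hγ0, abs_of_nonneg h2.1]
    exact add_le_add h2.2 (mul_le_mul_of_nonneg_left h1 hγ0)
  set B := 2 * Real.sqrt β₁ + H * C * (2 * τ + L * K * β) with hB
  have hM0 : 0 ≤ rmax / (1 - γ) := div_nonneg hrmax.le (by linarith)
  have hfin := aux_contr S hS γ (γ * (rmax / (1 - γ) * B)) hγ1
    (fun s a => Qstar s a - Qtstar s a) fun D hD s hs a => by
    have h1 := aux_avg S (Pt s a) (fun s' => (⨆ a', Qstar s' a') - ⨆ a', Qtstar s' a') D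
      (hPt0 s hs a) (hPt1 s hs a) (fun x hx => aux_sup _ _ D (hD x hx))
    have h2 : |∑ y ∈ S, (P s a y - Pt s a y) * ⨆ a', Qstar y a'| ≤ rmax / (1 - γ) * B := by
      refine (Finset.abs_sum_le_sum_abs _ _).trans ?_
      refine le_trans ?_ (mul_le_mul_of_nonneg_left (hTV s hs a) hM0)
      rw [Finset.mul_sum]
      refine Finset.sum_le_sum fun y hy => ?_
      rw [abs_mul, mul_comm]
      exact mul_le_mul_of_nonneg_right (aux_sup0 _ _ (hQb y hy)) (abs_nonneg _)
    have h3 : Qstar s a - Qtstar s a = γ * (∑ y ∈ S, (P s a y - Pt s a y) * ⨆ a', Qstar y a')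
        + γ * ∑ y ∈ S, Pt s a y * ((⨆ a', Qstar y a') - ⨆ a', Qtstar y a') := by
      rw [hQstar s hs a, hQtstar s hs a, ← mul_add, ← Finset.sum_add_distrib,
        add_sub_add_left_eq_sub, ← mul_sub, ← Finset.sum_sub_distrib]
      congr 1
      exact Finset.sum_congr rfl fun y _ => by ring
    show |Qstar s a - Qtstar s a| ≤ _
    rw [h3]
    refine (abs_add_le _ _).trans ?_
    rw [abs_mul, abs_mul, abs_of_nonneg hγ0]
    exact add_le_add (mul_le_mul_of_nonneg_left h2 hγ0) (mul_le_mul_of_nonneg_left h1 hγ0)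
  intro s hs a
  refine (hfin s hs a).trans (le_of_eq ?_)
  have : 1 - γ ≠ 0 := by linarith
  field_simp
end
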